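/- For every integer n ≥ 0 the very-well-poised hypergeometric series r_n satisfies r_n = u_n ζ(5) + w_n ζ(3) − v_n; in particular each r_n is a ℚ-linear form in 1, ζ(3), ζ(5) with the rational coefficients given by the solutions {u_n}, {w_n}, {v_n} of the auxiliary difference equation. -/

import Mathlib

noncomputable section

open Filter


/-- `a₀(n)` from recursion (1). -/
def a0 (x : ℚ) : ℚ := 41218*x^3 - 48459*x^2 + 20010*x - 2871

/-- `a₁(n)` from recursion (1). -/
def a1 (x : ℚ) : ℚ := 2*(48802112*x^9 + 89030880*x^8 + 36002654*x^7 - 24317344*x^6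
  - 19538418*x^5 + 1311365*x^4 + 3790503*x^3 + 460056*x^2 - 271701*x - 60291)

/-- `a₂(n)` from recursion (1). -/
def a2 (x : ℚ) : ℚ := 3874492*x^8 - 2617900*x^7 - 3144314*x^6 + 2947148*x^5
  + 647130*x^4 - 1182926*x^3 + 115771*x^2 + 170716*x - 44541

def b0 (x : ℚ) : ℚ := -a0 (-x)
def b1 (x : ℚ) : ℚ := a2 (-x)
def b2 (x : ℚ) : ℚ := -a1 (-x)

/-- The auxiliary difference equation (8), imposed for all integers `n ≥ 2`. -/
def Rec2 (y : ℕ → ℚ) : Prop := ∀ n : ℕ, 2 ≤ n →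
  (n : ℚ)*((n : ℚ) + 1)^5 * b0 ((n : ℚ) - 1) * y (n+1) - 2*(n : ℚ)*b1 (n : ℚ) * y n
    - b2 (n : ℚ) * y (n-1) + 2*((n : ℚ) - 1)^5*(2*(n : ℚ) - 1)*b0 (n : ℚ) * y (n-2) = 0

/-- The (real) value of the Riemann zeta function at a natural number argument. -/
def zetaRe (s : ℕ) : ℝ := (riemannZeta s).re

/-- The very-well-poised hypergeometric series `r_n`
(the summation index `k ≥ 1` is written as `k + 1` with `k : ℕ`). -/
def rr (n : ℕ) : ℝ := (Nat.factorial n : ℝ)^4 * ∑' k : ℕ,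
  (((k : ℝ) + 1) + (n : ℝ)/2)
    * (∏ j ∈ Finset.Icc 1 n, (((k : ℝ) + 1) - (j : ℝ)))
    * (∏ j ∈ Finset.Icc 1 n, (((k : ℝ) + 1) + (n : ℝ) + (j : ℝ)))
    / (∏ j ∈ Finset.range (n+1), (((k : ℝ) + 1) + (j : ℝ))^6)


/-- Real version of `b0`. -/
def B0 (x : ℝ) : ℝ := 41218*x^3 + 48459*x^2 + 20010*x + 2871

/-- Real version of `b1`. -/
def B1 (x : ℝ) : ℝ := 3874492*x^8 + 2617900*x^7 - 3144314*x^6 - 2947148*x^5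
  + 647130*x^4 + 1182926*x^3 + 115771*x^2 - 170716*x - 44541

/-- Real version of `b2`. -/
def B2 (x : ℝ) : ℝ := 2*(48802112*x^9 - 89030880*x^8 + 36002654*x^7 + 24317344*x^6
  - 19538418*x^5 - 1311365*x^4 + 3790503*x^3 - 460056*x^2 - 271701*x + 60291)

/-- Coefficient of `t^0` in the certificate. -/
def sc0 (m : ℝ) : ℝ :=
    (-2915872554496) + (-30471243751936)*m + (-143036230368256)*m^2 + (-395428992735488)*m^3 +
    (-698921107778240)*m^4 + (-768691920363392)*m^5 + (-360108643691456)*m^6 +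
    (407019839563280)*m^7 + (1084011262818970)*m^8 + (1302088233553946)*m^9 +
    (1068073123806588)*m^10 + (654218951973464)*m^11 + (308574286234068)*m^12 +
    (113043947726940)*m^13 + (32014509667092)*m^14 + (6892630984680)*m^15 +
    (1092492715634)*m^16 + (120346738482)*m^17 + (8236800144)*m^18 + (263960072)*m^19

/-- Coefficient of `t^1` in the certificate. -/
def sc1 (m : ℝ) : ℝ :=
    (11079984727040) + (152873959328256)*m + (947027604003200)*m^2 + (3549212097738368)*m^3 +
    (9094420667873440)*m^4 + (17013856710767616)*m^5 + (24177080164457672)*m^6 +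
    (26758257724072936)*m^7 + (23432210639505490)*m^8 + (16383911507028690)*m^9 +
    (9180472065335946)*m^10 + (4116997319116924)*m^11 + (1467920856355366)*m^12 +
    (410784268319168)*m^13 + (88291552266900)*m^14 + (14071316799154)*m^15 +
    (1566601630226)*m^16 + (108768928064)*m^17 + (3545572360)*m^18

/-- Coefficient of `t^2` in the certificate. -/
def sc2 (m : ℝ) : ℝ :=
    (70643635467264) + (797448566453760)*m + (4165860404724928)*m^2 + (13410170897085536)*m^3 +
    (29849795351904416)*m^4 + (48828164183168624)*m^5 + (60851627966966172)*m^6 +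
    (59068192789835022)*m^7 + (45246957576160088)*m^8 + (27524567187017174)*m^9 +
    (13303601351393048)*m^10 + (5082158312006860)*m^11 + (1516233526986816)*m^12 +
    (345980748059520)*m^13 + (58327469435928)*m^14 + (6847409447276)*m^15 + (499902117152)*m^16
    + (17091950496)*m^17

/-- Coefficient of `t^3` in the certificate. -/
def sc3 (m : ℝ) : ℝ :=
    (141902273777280) + (1450590562121664)*m + (6877762338863872)*m^2 + (20100738889429952)*m^3
    + (40566872725819736)*m^4 + (59992470514420124)*m^5 + (67289700850567028)*m^6 +
    (58421026558295574)*m^7 + (39693909906964411)*m^8 + (21183792551529734)*m^9 +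
    (8852951683536148)*m^10 + (2867427517304302)*m^11 + (705792624921889)*m^12 +
    (127649304008790)*m^13 + (16000518811048)*m^14 + (1242092300768)*m^15 + (44991260592)*m^16

/-- Coefficient of `t^4` in the certificate. -/
def sc4 (m : ℝ) : ℝ :=
    (159362053182912) + (1496787057059552)*m + (6510595915675776)*m^2 + (17407721582744320)*m^3
    + (32011467325157004)*m^4 + (42902419115209182)*m^5 + (43304445854213186)*m^6 +
    (33530542951129061)*m^7 + (20084452466420907)*m^8 + (9308281992415844)*m^9 +
    (3311127851614962)*m^10 + (887904741404355)*m^11 + (173766130595269)*m^12 +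
    (23432182780646)*m^13 + (1947027637416)*m^14 + (75155417352)*m^15

/-- Coefficient of `t^5` in the certificate. -/
def sc5 (m : ℝ) : ℝ :=
    (116122850019168) + (1004705540604336)*m + (4011998316259560)*m^2 + (9803103576502940)*m^3
    + (16378281096324056)*m^4 + (19795910550930734)*m^5 + (17852945309971916)*m^6 +
    (12205615832263223)*m^7 + (6357400414050170)*m^8 + (2510647453657912)*m^9 +
    (740056071632215)*m^10 + (157896961826863)*m^11 + (23051912156761)*m^12 +
    (2061362912674)*m^13 + (85186394704)*m^14

/-- Coefficient of `t^6` in the certificate. -/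
def sc6 (m : ℝ) : ℝ :=
    (58162079957168) + (462589415373392)*m + (1689732010903804)*m^2 + (3753633590206144)*m^3 +
    (5658076676938428)*m^4 + (6111484006958498)*m^5 + (4866609467133058)*m^6 +
    (2892713644678556)*m^7 + (1283458466593866)*m^8 + (419813387057141)*m^9 +
    (98398691570981)*m^10 + (15649873437993)*m^11 + (1513794029433)*m^12 + (67257512718)*m^13

/-- Coefficient of `t^7` in the certificate. -/
def sc7 (m : ℝ) : ℝ :=
    (20300796581144) + (147635782399900)*m + (489948362912264)*m^2 + (981072690045396)*m^3 +
    (1320095986888062)*m^4 + (1257382904269778)*m^5 + (869250932074872)*m^6 +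
    (439425555102546)*m^7 + (161203871015017)*m^8 + (41849870190327)*m^9 + (7297551548081)*m^10
    + (767378145265)*m^11 + (36798729694)*m^12

/-- Coefficient of `t^8` in the certificate. -/
def sc8 (m : ℝ) : ℝ :=
    (4804997987766) + (31658044686802)*m + (94407898827380)*m^2 + (168183978136088)*m^3 +
    (198845168994216)*m^4 + (163807487395720)*m^5 + (95931261000792)*m^6 + (39933824588417)*m^7
    + (11578455251767)*m^8 + (2226647554969)*m^9 + (255588785877)*m^10 + (13265065286)*m^11

/-- Coefficient of `t^9` in the certificate. -/
def sc9 (m : ℝ) : ℝ :=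
    (686094396522) + (4016748862812)*m + (10531572318844)*m^2 + (16282958451830)*m^3 +
    (16438604375288)*m^4 + (11322056871484)*m^5 + (5387380494750)*m^6 + (1748641169569)*m^7 +
    (370507523578)*m^8 + (46273588777)*m^9 + (2586718026)*m^10

/-- Coefficient of `t^10` in the certificate. -/
def sc10 (m : ℝ) : ℝ :=
    (25741322964) + (112030144409)*m + (205702512659)*m^2 + (203403926031)*m^3 +
    (111848941585)*m^4 + (28099785642)*m^5 + (-2620461870)*m^6 + (-3742226772)*m^7 +
    (-943321832)*m^8 + (-83095488)*m^9

/-- Coefficient of `t^11` in the certificate. -/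
def sc11 (m : ℝ) : ℝ :=
    (-12186862569) + (-62016950659)*m + (-135862176366)*m^2 + (-167495533221)*m^3 +
    (-127168847019)*m^4 + (-60911295258)*m^5 + (-17980305810)*m^6 + (-2991683762)*m^7 +
    (-214910652)*m^8

/-- Coefficient of `t^12` in the certificate. -/
def sc12 (m : ℝ) : ℝ :=
    (-3243612946) + (-13656637449)*m + (-24291175643)*m^2 + (-23665238919)*m^3 +
    (-13639058867)*m^4 + (-4650711814)*m^5 + (-868985726)*m^6 + (-68669188)*m^7

/-- Coefficient of `t^13` in the certificate. -/
def sc13 (m : ℝ) : ℝ :=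
    (-459974452) + (-1578491285)*m + (-2220498357)*m^2 + (-1639285263)*m^3 + (-670080901)*m^4 +
    (-143896494)*m^5 + (-12695144)*m^6

/-- Coefficient of `t^14` in the certificate. -/
def sc14 (m : ℝ) : ℝ :=
    (-40785912) + (-108789306)*m + (-113951304)*m^2 + (-58640562)*m^3 + (-14851848)*m^4 +
    (-1483848)*m^5

/-- Coefficient of `t^15` in the certificate. -/
def sc15 (m : ℝ) : ℝ :=
    (-1699413) + (-3258328)*m + (-2304225)*m^2 + (-715188)*m^3 + (-82436)*m^4

/-- The polynomial certificate, in `t` for fixed `m`. -/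
def sp (m t : ℝ) : ℝ := sc0 m * t^0
    + sc1 m * t^1
    + sc2 m * t^2
    + sc3 m * t^3
    + sc4 m * t^4
    + sc5 m * t^5
    + sc6 m * t^6
    + sc7 m * t^7
    + sc8 m * t^8
    + sc9 m * t^9
    + sc10 m * t^10
    + sc11 m * t^11
    + sc12 m * t^12
    + sc13 m * t^13
    + sc14 m * t^14
    + sc15 m * t^15

set_option maxHeartbeats 4000000 in
lemma cert_poly (m t : ℝ) :
    ((m+2)*(m+3)^5*B0 (m+1)) * ((m+2)^4*(m+3)^4*(2*t+m+3)*(t-m-1)*(t-m-2)*(t-m-3)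
      *(t+2*m+1)*(t+2*m+2)*(t+2*m+3)*(t+2*m+4)*(t+2*m+5)*(t+2*m+6))
    - (2*(m+2)*B1 (m+2)) * ((m+2)^4*(2*t+m+2)*(t-m-1)*(t-m-2)
      *(t+2*m+1)*(t+2*m+2)*(t+2*m+3)*(t+2*m+4)*(t+m+3)^7)
    - B2 (m+2) * ((2*t+m+1)*(t-m-1)*(t+2*m+1)*(t+2*m+2)*(t+m+2)^7*(t+m+3)^7)
    + (2*(m+1)*(2*m+3)*B0 (m+2)) * ((2*t+m)*(t+m+1)^7*(t+m+2)^7*(t+m+3)^7)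
    = sp m (t+1) * t^7 * (t+2*m+1) - sp m t * (t-m-1) * (t+m+3)^7 := by
  simp only [B0, B1, B2, sp, sc0, sc1, sc2, sc3, sc4, sc5, sc6, sc7, sc8, sc9, sc10, sc11, sc12, sc13, sc14, sc15]
  ring

/-- The hypergeometric term without its linear factor, built by its ratio in `m`. -/
def gg : ℕ → ℝ → ℝ
  | 0, t => 1 / t^6
  | m+1, t => gg m t * (((m:ℝ)+1)^4 * (t-m-1) * (t+2*m+1) * (t+2*m+2) / (t+m+1)^7)

lemma gg_succ (m : ℕ) (t : ℝ) : gg (m+1) t =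
    gg m t * (((m:ℝ)+1)^4 * (t-m-1) * (t+2*m+1) * (t+2*m+2) / (t+m+1)^7) := rfl

lemma gg_shift (m : ℕ) (t : ℝ) (ht : 0 < t) :
    (t - m) * gg m (t+1) = gg m t * (t^7 * (t+2*m+1) / (t+m+1)^7) := by
  induction m with
  | zero =>
    simp only [gg, Nat.cast_zero]
    have : t + 1 ≠ 0 := by positivity
    field_simp
    ring
  | succ m ih =>
    rw [gg_succ, gg_succ]
    have h1 : t + m + 1 ≠ 0 := by positivity
    have h2 : t + m + 2 ≠ 0 := by positivity
    have e : (t - ((m+1:ℕ):ℝ)) * (gg m (t+1) * (((m:ℝ)+1)^4 * (t+1-m-1) * (t+1+2*m+1)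
        * (t+1+2*m+2) / (t+1+m+1)^7))
        = ((t-m) * gg m (t+1)) * (((m:ℝ)+1)^4 * (t-m-1) * (t+2*m+2)
        * (t+2*m+3) / (t+m+2)^7) := by
      push_cast
      rw [show t+1+m+1 = t+m+2 by ring]
      ring
    rw [e, ih]
    push_cast
    rw [show t+(m+1)+1 = t+m+2 by ring]
    field_simp
    ring

lemma gg_one (m : ℕ) : gg (m+1) 1 = 0 := by
  induction m with
  | zero => simp [gg]
  | succ m ih => rw [gg_succ, ih, zero_mul]

lemma gg_bound (m : ℕ) (t : ℝ) (ht : 0 < t) : |gg m t| ≤ 4^m / t^6 := by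
  induction m with
  | zero => simp [gg, abs_of_pos ht]
  | succ m ih =>
    rw [gg_succ, abs_mul]
    have hm : (0:ℝ) ≤ m := Nat.cast_nonneg m
    have hp : 0 < t + m + 1 := by positivity
    have key : |((m:ℝ)+1)^4 * (t-m-1) * (t+2*m+1) * (t+2*m+2) / (t+m+1)^7| ≤ 4 := by
      rw [abs_div, abs_of_pos (pow_pos hp 7), div_le_iff₀ (pow_pos hp 7),
        abs_mul, abs_mul, abs_mul, abs_of_nonneg (by positivity : (0:ℝ) ≤ ((m:ℝ)+1)^4),
        abs_of_nonneg (by positivity : (0:ℝ) ≤ t+2*m+1),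
        abs_of_nonneg (by positivity : (0:ℝ) ≤ t+2*m+2)]
      calc ((m:ℝ)+1)^4 * |t-m-1| * (t+2*m+1) * (t+2*m+2)
          ≤ (t+m+1)^4 * (t+m+1) * (2*(t+m+1)) * (2*(t+m+1)) := by
            gcongr
            · linarith
            · rw [abs_le]; constructor <;> linarith
            · linarith
            · linarith
        _ = 4 * (t+m+1)^7 := by ring
    calc |gg m t| * _ ≤ (4^m / t^6) * 4 := by gcongr
      _ = 4^(m+1) / t^6 := by ring

lemma prodB (n : ℕ) (t : ℝ) :
    (∏ j ∈ Finset.Icc 1 (n+1), (t + ((n+1:ℕ):ℝ) + (j:ℝ))) * (t+n+1)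
      = (∏ j ∈ Finset.Icc 1 n, (t + (n:ℝ) + (j:ℝ))) * (t+2*n+1) * (t+2*n+2) := by
  have hcv : ∀ N : ℕ, ∀ f : ℕ → ℝ, ∏ j ∈ Finset.Icc 1 N, f j = ∏ j ∈ Finset.range N, f (j+1) := by
    intro N f
    induction N with
    | zero => simp
    | succ N ih => rw [Finset.prod_Icc_succ_top (by omega), ih, Finset.prod_range_succ]
  rw [hcv, hcv]
  have h := Finset.prod_range_succ (fun j : ℕ => t + (n:ℝ) + ((j+1:ℕ):ℝ)) n
  have h' := Finset.prod_range_succ' (fun j : ℕ => t + (n:ℝ) + ((j+1:ℕ):ℝ)) n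
  rw [Finset.prod_range_succ]
  have e : ∏ j ∈ Finset.range n, (t + ((n+1:ℕ):ℝ) + ((j+1:ℕ):ℝ))
      = ∏ j ∈ Finset.range n, (t + (n:ℝ) + ((j+1+1:ℕ):ℝ)) := by
    apply Finset.prod_congr rfl
    intro j _
    push_cast; ring
  rw [e]
  rw [h] at h'
  push_cast at h' ⊢
  linear_combination (-(t+2*n+2)) * h'

lemma gg_eq (n : ℕ) (t : ℝ) (ht : 0 < t) :
    (Nat.factorial n : ℝ)^4 * ((∏ j ∈ Finset.Icc 1 n, (t - (j : ℝ)))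
      * (∏ j ∈ Finset.Icc 1 n, (t + (n : ℝ) + (j : ℝ)))
      / (∏ j ∈ Finset.range (n+1), (t + (j : ℝ))^6)) = gg n t := by
  induction n with
  | zero => simp [gg]
  | succ n ih =>
    rw [gg_succ, ← ih, Finset.prod_Icc_succ_top (by omega), Finset.prod_range_succ _ (n+1)]
    have hB := prodB n t
    have hp : t + n + 1 ≠ 0 := by positivity
    have hC : (∏ j ∈ Finset.range (n+1), (t + (j : ℝ))^6) ≠ 0 := by
      apply Finset.prod_ne_zero_iff.mpr
      intro j _
      positivity
    rw [Nat.factorial_succ]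
    set C := ∏ j ∈ Finset.range (n+1), (t + (j : ℝ))^6
    set A := ∏ j ∈ Finset.Icc 1 n, (t - (j : ℝ))
    set B := ∏ j ∈ Finset.Icc 1 n, (t + (n : ℝ) + (j : ℝ))
    have hB' : (∏ j ∈ Finset.Icc 1 (n+1), (t + ((n+1:ℕ):ℝ) + (j:ℝ)))
      = B * (t+2*n+1) * (t+2*n+2) / (t+n+1) := by
      rw [eq_div_iff hp, hB]
    rw [hB']
    push_cast
    rw [show t + ((n:ℝ)+1) = t+n+1 by ring]
    field_simp
    ring

/-- The summand of `rr`, including the factorial. -/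
def RR (n : ℕ) (t : ℝ) : ℝ := (t + (n:ℝ)/2) * gg n t

lemma rr_eq (n : ℕ) : rr n = ∑' k : ℕ, RR n ((k:ℝ)+1) := by
  unfold rr
  rw [← tsum_mul_left]
  congr 1
  ext k
  rw [RR, ← gg_eq n _ (by positivity : (0:ℝ) < (k:ℝ)+1)]
  ring

/-- The telescoping certificate. -/
def SS (m : ℕ) (t : ℝ) : ℝ :=
  ((m:ℝ)+1)^4 / 2 * sp m t * (t-m-1) * gg m t / ((t+m+1)^7 * (t+m+2)^7)

lemma telescope (m : ℕ) (t : ℝ) (ht : 0 < t) :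
    (((m:ℝ)+2)*((m:ℝ)+3)^5*B0 (m+1)) * RR (m+3) t - (2*((m:ℝ)+2)*B1 (m+2)) * RR (m+2) t
      - B2 ((m:ℝ)+2) * RR (m+1) t + (2*((m:ℝ)+1)^5*(2*m+3)*B0 (m+2)) * RR m t
      = SS m (t+1) - SS m t := by
  have hc := cert_poly (m:ℝ) t
  have hs := gg_shift m t ht
  have h1 : t + m + 1 ≠ 0 := by positivity
  have h2 : t + m + 2 ≠ 0 := by positivity
  have h3 : t + m + 3 ≠ 0 := by positivity
  have hS : SS m (t+1) = ((m:ℝ)+1)^4 / 2 * sp m (t+1) *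
      (gg m t * (t^7 * (t+2*m+1) / (t+m+1)^7)) / ((t+m+2)^7 * (t+m+3)^7) := by
    rw [← hs, SS, show t+1+(m:ℝ)+1 = t+m+2 by ring, show t+1+(m:ℝ)+2 = t+m+3 by ring]
    ring
  rw [hS, SS]
  simp only [RR, gg_succ]
  push_cast
  rw [show t+((m:ℝ)+2)+1 = t+m+3 by ring, show t+((m:ℝ)+1)+1 = t+m+2 by ring]
  generalize sp (m:ℝ) (t+1) = s1 at *
  generalize sp (m:ℝ) t = s0 at *
  generalize B0 ((m:ℝ)+1) = x0 at *
  generalize B0 ((m:ℝ)+2) = x1 at *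
  generalize B1 ((m:ℝ)+2) = x2 at *
  generalize B2 ((m:ℝ)+2) = x3 at *
  generalize gg m t = G at *
  generalize (m:ℝ) = M at *
  have p1 := pow_ne_zero 7 h1
  have p2 := pow_ne_zero 7 h2
  have p3 := pow_ne_zero 7 h3
  clear hs hS h1 h2 h3
  generalize (t+M+1)^7 = P1 at *
  generalize (t+M+2)^7 = P2 at *
  generalize (t+M+3)^7 = P3 at *
  trans (M+1)^4/2 * G * (s1 * t^7 * (t+2*M+1) - s0 * (t-M-1) * P3) / (P1*P2*P3)
  · rw [← hc]
    field_simp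
    ring
  · field_simp

lemma cont_bound (m : ℝ) : ∃ K : ℝ, 0 ≤ K ∧ ∀ t : ℝ, 1 ≤ t → |sp m t| ≤ K * t^15 := by
  refine ⟨|sc0 m|+|sc1 m|+|sc2 m|+|sc3 m|+|sc4 m|+|sc5 m|+|sc6 m|+|sc7 m|+|sc8 m|+|sc9 m|
    +|sc10 m|+|sc11 m|+|sc12 m|+|sc13 m|+|sc14 m|+|sc15 m|, by positivity, ?_⟩
  intro t ht
  have h : ∀ (c : ℝ) (i : ℕ), i ≤ 15 → |c * t^i| ≤ |c| * t^15 := by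
    intro c i hi
    rw [abs_mul, abs_of_nonneg (by positivity : (0:ℝ) ≤ t^i)]
    exact mul_le_mul_of_nonneg_left (pow_le_pow_right₀ ht hi) (abs_nonneg c)
  simp only [sp, add_mul]
  iterate 15 refine (abs_add_le _ _).trans (add_le_add ?_ (h _ _ (by norm_num)))
  exact h _ _ (by norm_num)

lemma summable_inv (s : ℕ) (hs : 1 < s) : Summable (fun k : ℕ => 1 / ((k:ℝ)+1)^s) := by
  have := (summable_nat_add_iff 1).mpr (Real.summable_one_div_nat_pow.mpr hs)
  simpa using this

lemma RR_summable (m : ℕ) : Summable (fun k : ℕ => RR m ((k:ℝ)+1)) := by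
  apply Summable.of_norm_bounded ((summable_inv 5 (by norm_num)).mul_left (((m:ℝ)+1)*4^m))
  intro k
  have hk : (0:ℝ) ≤ k := Nat.cast_nonneg k
  have hm : (0:ℝ) ≤ m := Nat.cast_nonneg m
  generalize htt : (k:ℝ)+1 = t
  have ht : 1 ≤ t := by linarith
  have htp : 0 < t := by linarith
  rw [Real.norm_eq_abs, RR, abs_mul, abs_of_nonneg (by positivity : (0:ℝ) ≤ t + m/2)]
  calc (t + m/2) * |gg m t| ≤ (((m:ℝ)+1)*t) * (4^m/t^6) := by
        gcongr
        · nlinarith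
        · exact gg_bound m t htp
    _ = _ := by field_simp

lemma inv_tendsto (s : ℕ) (hs : s ≠ 0) :
    Tendsto (fun k : ℕ => 1 / ((k:ℝ)+1)^s) atTop (nhds 0) := by
  have h := (tendsto_one_div_add_atTop_nhds_zero_nat (𝕜 := ℝ)).pow s
  simpa [hs] using h

lemma SS_tendsto (m : ℕ) : Tendsto (fun k : ℕ => SS m ((k:ℝ)+1)) atTop (nhds 0) := by
  obtain ⟨K, hK0, hK⟩ := cont_bound m
  have h0 := (inv_tendsto 1 (by norm_num)).const_mul (((m:ℝ)+1)^4/2 * K * 4^m)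
  rw [mul_zero] at h0
  refine squeeze_zero_norm ?_ h0
  intro k
  have hk : (0:ℝ) ≤ k := Nat.cast_nonneg k
  have hm : (0:ℝ) ≤ m := Nat.cast_nonneg m
  generalize htt : (k:ℝ)+1 = t
  have ht : 1 ≤ t := by linarith
  have htp : 0 < t := by linarith
  have hp1 : 0 < t + m + 1 := by positivity
  have hp2 : 0 < t + m + 2 := by positivity
  rw [Real.norm_eq_abs, SS, abs_div, abs_of_pos (by positivity : 0 < (t+m+1)^7 * (t+(m:ℝ)+2)^7),
    abs_mul, abs_mul, abs_mul, abs_of_pos (by positivity : 0 < ((m:ℝ)+1)^4/2),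
    div_le_iff₀ (by positivity)]
  calc ((m:ℝ)+1)^4/2 * |sp m t| * |t-m-1| * |gg m t|
      ≤ ((m:ℝ)+1)^4/2 * (K * t^15) * (t+m+1) * (4^m/t^6) := by
        gcongr
        · exact hK t ht
        · rw [abs_le]; constructor <;> linarith
        · exact gg_bound m t htp
    _ = ((m:ℝ)+1)^4/2 * K * 4^m * (1/t^1) * (t^10 * (t+m+1)) := by field_simp
    _ ≤ ((m:ℝ)+1)^4/2 * K * 4^m * (1/t^1) * ((t+m+1)^7 * (t+m+2)^7) := by
        have a1 : t^6 ≤ (t+m+1)^6 := pow_le_pow_left₀ htp.le (by linarith) 6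
        have a2 : t^4 ≤ t^7 := pow_le_pow_right₀ ht (by norm_num)
        have a3 : t^7 ≤ (t+m+2)^7 := pow_le_pow_left₀ htp.le (by linarith) 7
        have a4 : t^10 * (t+m+1) ≤ (t+m+1)^7 * (t+m+2)^7 := by
          calc t^10 * (t+m+1) = t^6 * (t+m+1) * t^4 := by ring
            _ ≤ (t+m+1)^6 * (t+m+1) * (t+m+2)^7 := by
              gcongr
              exact a2.trans a3
            _ = _ := by ring
        gcongr

lemma SS_one (m : ℕ) : SS m 1 = 0 := by
  unfold SS
  cases m with
  | zero => simp
  | succ m => rw [gg_one]; simp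

lemma hasSum_tele (f : ℕ → ℝ) (c : ℝ) (hs : Summable (fun k => f (k+1) - f k))
    (hf : Tendsto f atTop (nhds 0)) (h0 : f 0 = c) : ∑' k, (f (k+1) - f k) = -c := by
  have h1 := hs.hasSum.tendsto_sum_nat
  have h2 : Tendsto (fun n => ∑ k ∈ Finset.range n, (f (k+1) - f k)) atTop (nhds (-c)) := by
    simp only [Finset.sum_range_sub, h0]
    simpa using hf.sub_const c
  exact tendsto_nhds_unique h1 h2

lemma rr_rec (m : ℕ) :
    (((m:ℝ)+2)*((m:ℝ)+3)^5*B0 (m+1)) * rr (m+3) - (2*((m:ℝ)+2)*B1 (m+2)) * rr (m+2)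
      - B2 ((m:ℝ)+2) * rr (m+1) + (2*((m:ℝ)+1)^5*(2*m+3)*B0 (m+2)) * rr m = 0 := by
  have S3 := (RR_summable (m+3)).mul_left (((m:ℝ)+2)*((m:ℝ)+3)^5*B0 (m+1))
  have S2 := (RR_summable (m+2)).mul_left (2*((m:ℝ)+2)*B1 (m+2))
  have S1 := (RR_summable (m+1)).mul_left (B2 ((m:ℝ)+2))
  have S0 := (RR_summable m).mul_left (2*((m:ℝ)+1)^5*(2*m+3)*B0 (m+2))
  simp only [rr_eq]
  rw [← tsum_mul_left, ← tsum_mul_left, ← tsum_mul_left, ← tsum_mul_left,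
    ← S3.tsum_sub S2, ← (S3.sub S2).tsum_sub S1, ← ((S3.sub S2).sub S1).tsum_add S0]
  have hS := ((S3.sub S2).sub S1).add S0
  have e : ∀ k : ℕ, (((m:ℝ)+2)*((m:ℝ)+3)^5*B0 (m+1)) * RR (m+3) ((k:ℝ)+1)
      - (2*((m:ℝ)+2)*B1 (m+2)) * RR (m+2) ((k:ℝ)+1)
      - B2 ((m:ℝ)+2) * RR (m+1) ((k:ℝ)+1)
      + (2*((m:ℝ)+1)^5*(2*m+3)*B0 (m+2)) * RR m ((k:ℝ)+1)
      = SS m (((k+1:ℕ):ℝ)+1) - SS m ((k:ℝ)+1) := by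
    intro k
    rw [telescope m _ (by positivity)]
    push_cast
    rfl
  rw [tsum_congr e]
  have hS' : Summable (fun k : ℕ => SS m (((k+1:ℕ):ℝ)+1) - SS m ((k:ℝ)+1)) :=
    hS.congr e
  have := hasSum_tele (fun k : ℕ => SS m ((k:ℝ)+1)) 0 hS' (SS_tendsto m)
    (by simpa using SS_one m)
  simpa using this

lemma zetaRe_eq (s : ℕ) (hs : 1 < s) : zetaRe s = ∑' k : ℕ, 1 / ((k:ℝ)+1)^s := by
  have h1 := zeta_nat_eq_tsum_of_gt_one hs
  have h2 : (riemannZeta s) = ((∑' n : ℕ, 1 / (n:ℝ)^s : ℝ) : ℂ) := by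
    rw [h1]; push_cast; rfl
  rw [zetaRe, h2, Complex.ofReal_re,
    (Real.summable_one_div_nat_pow.mpr hs).tsum_eq_zero_add]
  have : s ≠ 0 := by omega
  simp [this]

lemma init_of (n : ℕ) (a b c : ℝ) (T : ℝ → ℝ)
    (hT : Tendsto (fun k : ℕ => T ((k:ℝ)+1)) atTop (nhds 0)) (hT1 : T 1 = c)
    (h : ∀ t : ℝ, 0 < t → RR n t = a * (1/t^5) + b * (1/t^3) + (T (t+1) - T t)) :
    rr n = a * zetaRe 5 + b * zetaRe 3 - c := by
  have s5 := (summable_inv 5 (by norm_num)).mul_left a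
  have s3 := (summable_inv 3 (by norm_num)).mul_left b
  have hR := RR_summable n
  have e : ∀ k : ℕ, RR n ((k:ℝ)+1) - (a * (1/((k:ℝ)+1)^5) + b * (1/((k:ℝ)+1)^3))
      = T (((k+1:ℕ):ℝ)+1) - T ((k:ℝ)+1) := by
    intro k
    rw [h _ (by positivity)]
    push_cast
    ring
  have hs : Summable (fun k : ℕ => T (((k+1:ℕ):ℝ)+1) - T ((k:ℝ)+1)) :=
    (hR.sub (s5.add s3)).congr e
  have ht := hasSum_tele (fun k : ℕ => T ((k:ℝ)+1)) c hs hT (by simpa using hT1)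
  have h2 := hR.tsum_sub (s5.add s3)
  rw [tsum_congr e, s5.tsum_add s3, tsum_mul_left, tsum_mul_left,
    ← zetaRe_eq 5 (by norm_num), ← zetaRe_eq 3 (by norm_num), ← rr_eq, ht] at h2
  linarith

lemma rr_zero : rr 0 = 1 * zetaRe 5 + 0 * zetaRe 3 - 0 := by
  apply init_of 0 1 0 0 (fun _ => 0) tendsto_const_nhds rfl
  intro t ht
  simp only [RR, gg]
  field_simp
  simp

lemma inv_tendsto' (s : ℕ) (hs : s ≠ 0) (c : ℝ) :
    Tendsto (fun k : ℕ => c / ((k:ℝ)+1)^s) atTop (nhds 0) := by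
  have := (inv_tendsto s hs).const_mul c
  rw [mul_zero] at this
  exact this.congr (fun k => by ring)

lemma inv_tendsto'' (s : ℕ) (hs : s ≠ 0) (c : ℝ) :
    Tendsto (fun k : ℕ => c / ((k:ℝ)+1+1)^s) atTop (nhds 0) := by
  have := (inv_tendsto' s hs c).comp (tendsto_add_atTop_nat 1)
  exact this.congr (fun k => by simp)

lemma rr_one : rr 1 = 9 * zetaRe 5 + 33 * zetaRe 3 - 49 := by
  apply init_of 1 9 33 49 (fun t => (33/2)/t^2 + (33/2)/t^3 + (21/2)/t^4 + (9/2)/t^5 + 1/t^6)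
  · have := ((((inv_tendsto' 2 (by norm_num) (33/2)).add (inv_tendsto' 3 (by norm_num) (33/2))).add
      (inv_tendsto' 4 (by norm_num) (21/2))).add (inv_tendsto' 5 (by norm_num) (9/2))).add
      (inv_tendsto' 6 (by norm_num) 1)
    simpa only [add_zero] using this
  · norm_num
  intro t ht
  simp only [RR, gg]
  have : t + 1 ≠ 0 := by positivity
  push_cast
  rw [show t + 0 + 1 = t + 1 by ring]
  field_simp
  ring

set_option maxHeartbeats 1000000 in
lemma rr_two : rr 2 = 469 * zetaRe 5 + (6125/4) * zetaRe 3 - 74463/32 := by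
  apply init_of 2 469 (6125/4) (74463/32) (fun t => 5432/t^1 + (-37331/16)/t^2 + (19117/8)/t^3
    + (-1015/4)/t^4 + (1045/2)/t^5 + (-6)/t^6 + (-5432)/(t+1)^1 + (-37331/16)/(t+1)^2
    + (-6867/8)/(t+1)^3 + (-1015/4)/(t+1)^4 + (-107/2)/(t+1)^5 + (-6)/(t+1)^6)
  · have h : ∀ {f g : ℕ → ℝ}, Tendsto f atTop (nhds 0) → Tendsto g atTop (nhds 0) →
        Tendsto (fun k => f k + g k) atTop (nhds 0) := by
      intro f g hf hg
      simpa using hf.add hg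
    iterate 6 refine h ?_ (inv_tendsto'' _ (by norm_num) _)
    iterate 5 refine h ?_ (inv_tendsto' _ (by norm_num) _)
    exact inv_tendsto' _ (by norm_num) _
  · norm_num
  intro t ht
  simp only [RR, gg]
  have h1 : t + 1 ≠ 0 := by positivity
  have h2 : t + 2 ≠ 0 := by positivity
  push_cast
  rw [show t + 0 + 1 = t + 1 by ring, show t + 1 + 1 = t + 2 by ring]
  field_simp
  ring

lemma cast_rec (y : ℕ → ℚ) (hy : Rec2 y) (m : ℕ) :
    (((m:ℝ)+2)*((m:ℝ)+3)^5*B0 (m+1)) * (y (m+3) : ℝ) - (2*((m:ℝ)+2)*B1 (m+2)) * (y (m+2) : ℝ)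
      - B2 ((m:ℝ)+2) * (y (m+1) : ℝ) + (2*((m:ℝ)+1)^5*(2*m+3)*B0 (m+2)) * (y m : ℝ) = 0 := by
  have h := hy (m+2) (by omega)
  rw [show m+2-1 = m+1 by omega, show m+2-2 = m by omega, show m+2+1 = m+3 by omega] at h
  have h' := congrArg (fun q : ℚ => (q:ℝ)) h
  simp only [b0, b1, b2, a0, a1, a2] at h'
  push_cast at h'
  simp only [B0, B1, B2]
  linear_combination h'

/-- For every `n ≥ 0`, `r_n = u_n ζ(5) + w_n ζ(3) − v_n`. -/
theorem stmt7
    (u w v : ℕ → ℚ)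
    (hu : Rec2 u) (hw : Rec2 w) (hv : Rec2 v)
    (hu0 : u 0 = 1) (hu1 : u 1 = 9) (hu2 : u 2 = 469)
    (hw0 : w 0 = 0) (hw1 : w 1 = 33) (hw2 : w 2 = 6125/4)
    (hv0 : v 0 = 0) (hv1 : v 1 = 49) (hv2 : v 2 = 74463/32) :
    ∀ n : ℕ, rr n = (u n : ℝ) * zetaRe 5 + (w n : ℝ) * zetaRe 3 - (v n : ℝ) := by
  have hx : ∀ m : ℕ, (((m:ℝ)+2)*((m:ℝ)+3)^5*B0 (m+1))
      * (rr (m+3) - ((u (m+3) : ℝ) * zetaRe 5 + (w (m+3) : ℝ) * zetaRe 3 - (v (m+3) : ℝ)))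
      - (2*((m:ℝ)+2)*B1 (m+2))
      * (rr (m+2) - ((u (m+2) : ℝ) * zetaRe 5 + (w (m+2) : ℝ) * zetaRe 3 - (v (m+2) : ℝ)))
      - B2 ((m:ℝ)+2)
      * (rr (m+1) - ((u (m+1) : ℝ) * zetaRe 5 + (w (m+1) : ℝ) * zetaRe 3 - (v (m+1) : ℝ)))
      + (2*((m:ℝ)+1)^5*(2*m+3)*B0 (m+2))
      * (rr m - ((u m : ℝ) * zetaRe 5 + (w m : ℝ) * zetaRe 3 - (v m : ℝ))) = 0 := by
    intro m
    linear_combination rr_rec m - zetaRe 5 * cast_rec u hu m - zetaRe 3 * cast_rec w hw m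
      + cast_rec v hv m
  intro n
  induction n using Nat.strong_induction_on with
  | _ n ih =>
    match n, ih with
    | 0, _ => rw [hu0, hw0, hv0, rr_zero]; push_cast; ring
    | 1, _ => rw [hu1, hw1, hv1, rr_one]; push_cast; ring
    | 2, _ => rw [hu2, hw2, hv2, rr_two]; push_cast; ring
    | m+3, ih =>
      have h := hx m
      rw [sub_eq_zero.mpr (ih (m+2) (by omega)), sub_eq_zero.mpr (ih (m+1) (by omega)),
        sub_eq_zero.mpr (ih m (by omega))] at h
      have hpos : ((m:ℝ)+2)*((m:ℝ)+3)^5*B0 (m+1) ≠ 0 := by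
        unfold B0
        positivity
      simp only [mul_zero, sub_zero, add_zero] at h
      exact sub_eq_zero.mp ((mul_eq_zero.mp h).resolve_left hpos)
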